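/- (Sign-robust uniform diagonal bound, matrix form.) Let l < u be real numbers, n ≥ 1 a natural number, δ > 0, and d ≥ 1. For each i ∈ {1,…,d}, let σ_i be a Bernstein activation on [l,u] with coefficients c^{(i)}_0, …, c^{(i)}_n, and suppose for each i either (a) c^{(i)}_{k+1} − c^{(i)}_k ≥ δ for all k, or (b) c^{(i)}_{k+1} − c^{(i)}_k ≤ −δ for all k. Then for every vector x ∈ [l,u]^d, the d×d diagonal matrix D with D_{ii} = |σ_i'(x_i)| satisfies D − (n·δ/(u−l))·I ⪰ 0, i.e., D − (n·δ/(u−l))·I is positive semidefinite. -/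

import Mathlib

/-- The Bernstein basis polynomial of degree `n`, index `k`, on the interval `[l, u]`. -/
noncomputable def bernBasis (l u : ℝ) (n k : ℕ) (x : ℝ) : ℝ :=
  (n.choose k : ℝ) / (u - l) ^ n * (x - l) ^ k * (u - x) ^ (n - k)

/-- The Bernstein activation with coefficients `c 0, …, c n` on `[l, u]`. -/
noncomputable def bernAct (l u : ℝ) (n : ℕ) (c : ℕ → ℝ) (x : ℝ) : ℝ :=
  ∑ k ∈ Finset.range (n + 1), c k * bernBasis l u n k x

theorem bernBasis_eq_eval {l u : ℝ} (hlu : l < u) (n k : ℕ) (x : ℝ) :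
    bernBasis l u n k x = (bernsteinPolynomial ℝ n k).eval ((x - l) / (u - l)) := by
  rcases lt_or_ge n k with h | h
  · simp [bernBasis, Nat.choose_eq_zero_of_lt h, bernsteinPolynomial.eq_zero_of_lt ℝ h]
  · have hne : u - l ≠ 0 := (sub_pos.2 hlu).ne'
    have h1 : 1 - (x - l) / (u - l) = (u - x) / (u - l) := by
      field_simp
      ring
    have h2 : (u - l) ^ n = (u - l) ^ k * (u - l) ^ (n - k) := by
      rw [← pow_add, Nat.add_sub_cancel' h]
    simp only [bernBasis, bernsteinPolynomial, Polynomial.eval_mul, Polynomial.eval_pow,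
      Polynomial.eval_natCast, Polynomial.eval_X, Polynomial.eval_sub, Polynomial.eval_one, h1, h2,
      div_pow]
    field_simp

theorem bernBasis_nonneg {l u : ℝ} (hlu : l < u) (n k : ℕ) {x : ℝ} (hx : x ∈ Set.Icc l u) :
    0 ≤ bernBasis l u n k x := by
  have h1 := sub_nonneg.2 hx.1
  have h2 := sub_nonneg.2 hx.2
  have h3 := sub_pos.2 hlu
  unfold bernBasis
  positivity

theorem sum_bernBasis {l u : ℝ} (hlu : l < u) (n : ℕ) (x : ℝ) :
    ∑ k ∈ Finset.range (n + 1), bernBasis l u n k x = 1 := by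
  simp only [bernBasis_eq_eval hlu, ← Polynomial.eval_finsetSum, bernsteinPolynomial.sum,
    Polynomial.eval_one]

theorem hasDerivAt_bernBasis {l u : ℝ} (hlu : l < u) (n k : ℕ) (x : ℝ) :
    HasDerivAt (bernBasis l u n k)
      ((Polynomial.derivative (bernsteinPolynomial ℝ n k)).eval ((x - l) / (u - l)) *
        (1 / (u - l))) x := by
  rw [show bernBasis l u n k = _ from funext (bernBasis_eq_eval hlu n k)]
  exact ((bernsteinPolynomial ℝ n k).hasDerivAt _).comp x
    (((hasDerivAt_id x).sub_const l).div_const (u - l))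

theorem hasDerivAt_bernAct_succ {l u : ℝ} (hlu : l < u) (m : ℕ) (c : ℕ → ℝ) (x : ℝ) :
    HasDerivAt (bernAct l u (m + 1) c)
      ((m + 1) / (u - l) *
        ∑ k ∈ Finset.range (m + 1), (c (k + 1) - c k) * bernBasis l u m k x) x := by
  have h := HasDerivAt.fun_sum (u := Finset.range (m + 1 + 1)) fun k _ =>
    (hasDerivAt_bernBasis hlu (m + 1) k x).const_mul (c k)
  refine h.congr_deriv ?_
  have hshift : ∑ k ∈ Finset.range (m + 1), c (k + 1) * bernBasis l u m (k + 1) x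
      + c 0 * bernBasis l u m 0 x = ∑ k ∈ Finset.range (m + 1), c k * bernBasis l u m k x := by
    rw [← Finset.sum_range_succ' (fun k => c k * bernBasis l u m k x), Finset.sum_range_succ]
    simp [bernBasis]
  rw [Finset.sum_range_succ']
  simp only [bernsteinPolynomial.derivative_succ, bernsteinPolynomial.derivative_zero,
    Polynomial.eval_mul, Polynomial.eval_sub, Polynomial.eval_neg, Polynomial.eval_natCast,
    Polynomial.eval_add, Polynomial.eval_one, Nat.add_sub_cancel, ← bernBasis_eq_eval hlu,
    Nat.cast_add, Nat.cast_one, sub_mul, Finset.sum_sub_distrib]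
  rw [← hshift, mul_sub, mul_add, Finset.mul_sum, Finset.mul_sum, ← sub_sub,
    ← Finset.sum_sub_distrib, sub_eq_add_neg]
  congr 1
  · exact Finset.sum_congr rfl fun k _ => by ring
  · ring

theorem le_deriv_bernAct {l u : ℝ} (hlu : l < u) {n : ℕ} (hn : 1 ≤ n) {δ : ℝ} {c : ℕ → ℝ}
    (hc : ∀ k < n, δ ≤ c (k + 1) - c k) {x : ℝ} (hx : x ∈ Set.Icc l u) :
    n * δ / (u - l) ≤ deriv (bernAct l u n c) x := by
  obtain ⟨m, rfl⟩ := Nat.exists_eq_add_of_le' hn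
  rw [(hasDerivAt_bernAct_succ hlu m c x).deriv, mul_div_right_comm, Nat.cast_add, Nat.cast_one]
  have hul := sub_pos.2 hlu
  refine mul_le_mul_of_nonneg_left ?_ (by positivity)
  calc δ = ∑ k ∈ Finset.range (m + 1), δ * bernBasis l u m k x := by
        rw [← Finset.mul_sum, sum_bernBasis hlu, mul_one]
    _ ≤ _ := Finset.sum_le_sum fun k hk =>
        mul_le_mul_of_nonneg_right (hc k (Finset.mem_range.1 hk)) (bernBasis_nonneg hlu m k hx)

theorem bernAct_neg (l u : ℝ) (n : ℕ) (c : ℕ → ℝ) :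
    bernAct l u n (-c) = -bernAct l u n c := by
  ext x
  simp [bernAct]

theorem le_abs_deriv_bernAct {l u : ℝ} (hlu : l < u) {n : ℕ} (hn : 1 ≤ n) {δ : ℝ} {c : ℕ → ℝ}
    (hc : (∀ k < n, δ ≤ c (k + 1) - c k) ∨ (∀ k < n, c (k + 1) - c k ≤ -δ))
    {x : ℝ} (hx : x ∈ Set.Icc l u) :
    n * δ / (u - l) ≤ |deriv (bernAct l u n c) x| := by
  rcases hc with hc | hc
  · exact (le_deriv_bernAct hlu hn hc hx).trans (le_abs_self _)
  · have h : ∀ k < n, δ ≤ (-c) (k + 1) - (-c) k := fun k hk => by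
      simp only [Pi.neg_apply]
      linarith [hc k hk]
    have := le_deriv_bernAct hlu hn h hx
    rw [bernAct_neg, deriv.neg] at this
    exact this.trans (neg_le_abs _)

/-- Sign-robust uniform diagonal bound, matrix form: if for each neuron
`i` the successive coefficient differences of `σ_i` are all `≥ δ` or all `≤ −δ`, then
for every `x ∈ [l,u]^d`, the diagonal matrix `D` with `D_{ii} = |σ_i'(x_i)|` satisfies
`D − (nδ/(u−l))·I ⪰ 0`. -/
theorem bernstein_diagonal_psd_bound (l u : ℝ) (hlu : l < u) (n : ℕ) (hn : 1 ≤ n)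
    (δ : ℝ) (hδ : 0 < δ) (d : ℕ) (hd : 1 ≤ d) (c : Fin d → ℕ → ℝ)
    (hc : ∀ i, (∀ k < n, δ ≤ c i (k + 1) - c i k) ∨ (∀ k < n, c i (k + 1) - c i k ≤ -δ))
    (x : Fin d → ℝ) (hx : ∀ i, x i ∈ Set.Icc l u) :
    (Matrix.diagonal (fun i => |deriv (bernAct l u n (c i)) (x i)|) -
        (n * δ / (u - l)) • (1 : Matrix (Fin d) (Fin d) ℝ)).PosSemidef := by
  rw [Matrix.smul_one_eq_diagonal, Matrix.diagonal_sub, Matrix.posSemidef_diagonal_iff]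
  exact fun i => sub_nonneg.2 (le_abs_deriv_bernAct hlu hn (hc i) (hx i))
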